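/- arXiv:2111.03051 — 3 statements merged into one kernel-verified Lean document; each statement's English description precedes it below -/
import Mathlib

section
/- (Theorem 1, part 1) Let k be a positive real number and n a real number with n/k > 1, and let T = ⌈ln(n/k)⌉ (a positive integer). Then the minimum worst-case resource utilization for discovering the k active devices among n devices using frequency-multiplexed group testing with at most T time-slots satisfies N_R^{min} = min_{t ∈ {1,...,T}} k·t·(n/k)^{1/t} ≤ k·T·(n/k)^{1/T} ≤ e·k·⌈ln(n/k)⌉. -/
/-- If `log x ≤ t` with `x, t > 0`, then the `t`-th root of `x` is at most `e`. -/
theorem Real.rpow_one_div_le_exp_one {x t : ℝ} (hx : 0 < x) (ht : 0 < t)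
    (hxt : Real.log x ≤ t) : x ^ (1 / t) ≤ Real.exp 1 := by
  rw [Real.rpow_def_of_pos hx, Real.exp_le_exp, mul_one_div]
  exact (div_le_one ht).mpr hxt

/-- Theorem 1, part 1: For `k > 0`, `n/k > 1`, and
`T = ⌈ln (n/k)⌉` (a positive integer), the minimum over integers `1 ≤ t ≤ T` of
`k * t * (n/k)^(1/t)` is at most `k * T * (n/k)^(1/T)`, which is at most
`e * k * ⌈ln (n/k)⌉`. -/
theorem freq_mux_GT_min_resource_bound_unconstrained
    (n k : ℝ) (hk : 0 < k) (h : 1 < n / k)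
    (T : ℕ) (hT : T = ⌈Real.log (n / k)⌉₊) :
    (Finset.Icc 1 T).inf'
        (Finset.nonempty_Icc.mpr (hT ▸ Nat.one_le_ceil_iff.mpr (Real.log_pos h)))
        (fun t : ℕ => k * t * (n / k) ^ ((1 : ℝ) / (t : ℝ)))
      ≤ k * T * (n / k) ^ ((1 : ℝ) / (T : ℝ))
    ∧ k * T * (n / k) ^ ((1 : ℝ) / (T : ℝ)) ≤ Real.exp 1 * k * T := by
  have hT1 : 1 ≤ T := hT ▸ Nat.one_le_ceil_iff.mpr (Real.log_pos h)
  refine ⟨Finset.inf'_le (fun t : ℕ => k * t * (n / k) ^ ((1 : ℝ) / (t : ℝ)))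
    (Finset.mem_Icc.mpr ⟨hT1, le_rfl⟩), ?_⟩
  have hroot : (n / k) ^ ((1 : ℝ) / (T : ℝ)) ≤ Real.exp 1 :=
    Real.rpow_one_div_le_exp_one (one_pos.trans h) (by exact_mod_cast hT1)
      (hT ▸ Nat.le_ceil _)
  calc k * T * (n / k) ^ ((1 : ℝ) / (T : ℝ)) ≤ k * T * Real.exp 1 := by gcongr
    _ = Real.exp 1 * k * T := by ring
end

section
/- Let N ≥ 2 be an integer and let n, k be positive real numbers. For every real β > 0, the worst-case resource utilization under the estimate k̂ = β·k satisfies N_R*(β) = k·(N + β − 1)·(n/(β·k))^{1/N} ≥ k·N·(n/k)^{1/N} = N_R*(1), with equality if and only if β = 1. Equivalently, the relative excess J(β) = N_R*(β)/N_R*(1) − 1 = ((N + β − 1)/N)·(1/β)^{1/N} − 1 is nonnegative and vanishes exactly at β = 1. -/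
/-- The resource utilization under an estimate off by a factor `β ≠ 1`, relative to the utilization
under the exact value, exceeds one. -/
theorem one_lt_relative_utilization {N : ℕ} (hN : 2 ≤ N) {β : ℝ} (hβ : 0 < β) (hβ_ne : β ≠ 1) :
    1 < ((N : ℝ) + β - 1) / N * (1 / β) ^ ((1 : ℝ) / N) := by
  have hN_gt : (1 : ℝ) < N := by exact_mod_cast hN
  have hN_pos : (0 : ℝ) < N := by linarith
  have bernoulli := rpow_one_add_lt_one_add_mul_self (s := β - 1) (by linarith)
    (sub_ne_zero.mpr hβ_ne) (one_div_pos.mpr hN_pos) ((div_lt_one hN_pos).mpr hN_gt)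
  have slope : 1 + 1 / (N : ℝ) * (β - 1) = ((N : ℝ) + β - 1) / N := by
    field_simp
    ring
  rw [add_sub_cancel, slope] at bernoulli
  rw [Real.div_rpow zero_le_one hβ.le, Real.one_rpow, mul_one_div]
  exact (one_lt_div (Real.rpow_pos_of_pos hβ _)).mpr bernoulli

/-- The utilization under the estimate `β * k` is the exact-value utilization times the relative
utilization. -/
theorem utilization_eq_mul_relative {N : ℕ} (hN : N ≠ 0) {n k β : ℝ} (hn : 0 < n) (hk : 0 < k)
    (hβ : 0 < β) :
    k * ((N : ℝ) + β - 1) * (n / (β * k)) ^ ((1 : ℝ) / N) =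
      k * N * (n / k) ^ ((1 : ℝ) / N) *
        (((N : ℝ) + β - 1) / N * (1 / β) ^ ((1 : ℝ) / N)) := by
  have split : n / (β * k) = n / k * (1 / β) := by field_simp
  have hN' : (N : ℝ) ≠ 0 := Nat.cast_ne_zero.mpr hN
  rw [split, Real.mul_rpow (by positivity) (by positivity)]
  field_simp


/-- For `N ≥ 2`, positive reals `n, k`, and any `β > 0`, the
worst-case resource utilization under the estimate `k̂ = β * k`, namely
`N_R*(β) = k * (N + β - 1) * (n / (β * k))^(1/N)`, is at least
`N_R*(1) = k * N * (n/k)^(1/N)`, with equality iff `β = 1`; equivalently the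
relative excess `J(β) = ((N + β - 1)/N) * (1/β)^(1/N) - 1` is nonnegative and
vanishes exactly at `β = 1`. -/
theorem freq_mux_GT_estimation_error_excess
    (N : ℕ) (hN : 2 ≤ N) (n k : ℝ) (hn : 0 < n) (hk : 0 < k)
    (β : ℝ) (hβ : 0 < β) :
    (k * ((N : ℝ) + β - 1) * (n / (β * k)) ^ ((1 : ℝ) / (N : ℝ))
        ≥ k * (N : ℝ) * (n / k) ^ ((1 : ℝ) / (N : ℝ)))
    ∧ (k * ((N : ℝ) + β - 1) * (n / (β * k)) ^ ((1 : ℝ) / (N : ℝ))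
          = k * (N : ℝ) * (n / k) ^ ((1 : ℝ) / (N : ℝ)) ↔ β = 1)
    ∧ (0 ≤ ((N : ℝ) + β - 1) / (N : ℝ) * (1 / β) ^ ((1 : ℝ) / (N : ℝ)) - 1)
    ∧ (((N : ℝ) + β - 1) / (N : ℝ) * (1 / β) ^ ((1 : ℝ) / (N : ℝ)) - 1 = 0
        ↔ β = 1) := by
  have hN_pos : (0 : ℝ) < N := by exact_mod_cast (by omega : 0 < N)
  have exact_pos : 0 < k * (N : ℝ) * (n / k) ^ ((1 : ℝ) / N) := by positivity
  rw [utilization_eq_mul_relative (by omega) hn hk hβ, ge_iff_le, le_mul_iff_one_le_right exact_pos,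
    mul_eq_left₀ exact_pos.ne', sub_nonneg, sub_eq_zero]
  have relative_eq_one_iff :
      ((N : ℝ) + β - 1) / N * (1 / β) ^ ((1 : ℝ) / N) = 1 ↔ β = 1 := by
    refine ⟨fun h ↦ ?_, fun h ↦ ?_⟩
    · by_contra hβ_ne
      exact (one_lt_relative_utilization hN hβ hβ_ne).ne' h
    · simp [h, hN_pos.ne']
  have one_le_relative : 1 ≤ ((N : ℝ) + β - 1) / N * (1 / β) ^ ((1 : ℝ) / N) := by
    rcases eq_or_ne β 1 with h | h
    · exact (relative_eq_one_iff.mpr h).ge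
    · exact (one_lt_relative_utilization hN hβ h).le
  exact ⟨one_le_relative, relative_eq_one_iff, one_le_relative, relative_eq_one_iff⟩
end

section
/- Let k be a positive integer and n a real number with n/k > 1. Then the total feedback of the frequency-multiplexed group testing strategy satisfies N_{FB} = ln(n/k)·log₂ C(⌈e·k⌉, k) < k·log₂(n/k)·(2 + (1/log₂ e)·log₂((k+1)/k)). -/
/-- The binomial coefficient `C(⌈e * k⌉, k)` is less than `(e² * (k+1) / k) ^ k`. -/
theorem choose_ceil_exp_mul_lt (k : ℕ) (hk : 0 < k) :
    ((Nat.choose ⌈Real.exp 1 * (k : ℝ)⌉₊ k : ℕ) : ℝ)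
      < (Real.exp 2 * (((k : ℝ) + 1) / (k : ℝ))) ^ k := by
  have hk' : (0 : ℝ) < k := by exact_mod_cast hk
  have he : (1 : ℝ) < Real.exp 1 := Real.one_lt_exp_iff.mpr one_pos
  have hceil : (⌈Real.exp 1 * (k : ℝ)⌉₊ : ℝ) < Real.exp 1 * (k + 1) := by
    have := Nat.ceil_lt_add_one (a := Real.exp 1 * (k : ℝ)) (by positivity)
    linarith
  have hfact : (k : ℝ) ^ k / (k.factorial : ℝ) ≤ Real.exp 1 ^ k := by
    rw [← Real.exp_nat_mul, mul_one]
    exact Real.pow_div_factorial_le_exp _ hk'.le k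
  have hpow : (⌈Real.exp 1 * (k : ℝ)⌉₊ : ℝ) ^ k < (Real.exp 1 * (k + 1)) ^ k :=
    pow_lt_pow_left₀ hceil (by positivity) hk.ne'
  have hexp : Real.exp 2 = Real.exp 1 * Real.exp 1 := by
    rw [← Real.exp_add]; norm_num
  calc ((Nat.choose ⌈Real.exp 1 * (k : ℝ)⌉₊ k : ℕ) : ℝ)
      ≤ (⌈Real.exp 1 * (k : ℝ)⌉₊ : ℝ) ^ k / (k.factorial : ℝ) := Nat.choose_le_pow_div _ _
    _ < (Real.exp 1 * (k + 1)) ^ k / (k.factorial : ℝ) := by gcongr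
    _ = (Real.exp 1 * ((k + 1) / k)) ^ k * ((k : ℝ) ^ k / (k.factorial : ℝ)) := by
      rw [← mul_div_assoc, ← mul_pow]
      congr 2
      field_simp
    _ ≤ (Real.exp 1 * ((k + 1) / k)) ^ k * Real.exp 1 ^ k := by gcongr
    _ = (Real.exp 2 * (((k : ℝ) + 1) / (k : ℝ))) ^ k := by
      rw [← mul_pow, hexp]
      ring

/-- For a positive integer `k` and a real `n` with `n/k > 1`, the
total feedback of the frequency-multiplexed GT strategy satisfies
`N_FB = ln (n/k) * log₂ C(⌈e*k⌉, k)
      < k * log₂ (n/k) * (2 + (1 / log₂ e) * log₂ ((k+1)/k))`. -/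
theorem freq_mux_GT_feedback_bound (k : ℕ) (hk : 0 < k) (n : ℝ)
    (h : 1 < n / (k : ℝ)) :
    Real.log (n / (k : ℝ))
        * Real.logb 2 ((Nat.choose ⌈Real.exp 1 * (k : ℝ)⌉₊ k : ℕ) : ℝ)
      < (k : ℝ) * Real.logb 2 (n / (k : ℝ))
          * (2 + (1 / Real.logb 2 (Real.exp 1))
              * Real.logb 2 (((k : ℝ) + 1) / (k : ℝ))) := by
  have hk' : (0 : ℝ) < k := by exact_mod_cast hk
  have hL : 0 < Real.log (n / (k : ℝ)) := Real.log_pos h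
  have h2 : 0 < Real.log 2 := Real.log_pos one_lt_two
  have hC : 0 < ((Nat.choose ⌈Real.exp 1 * (k : ℝ)⌉₊ k : ℕ) : ℝ) := by
    have hle : k ≤ ⌈Real.exp 1 * (k : ℝ)⌉₊ := by
      have he : (1 : ℝ) ≤ Real.exp 1 := Real.one_le_exp zero_le_one
      exact_mod_cast (le_mul_of_one_le_left hk'.le he).trans (Nat.le_ceil _)
    exact_mod_cast Nat.choose_pos hle
  have hlog := Real.log_lt_log hC (choose_ceil_exp_mul_lt k hk)
  rw [Real.log_pow, Real.log_mul (Real.exp_ne_zero _) (by positivity), Real.log_exp] at hlog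
  have hscale := mul_lt_mul_of_pos_left hlog (div_pos hL h2)
  simp only [Real.logb, Real.log_exp]
  calc _ = Real.log (n / (k : ℝ)) / Real.log 2
          * Real.log ((Nat.choose ⌈Real.exp 1 * (k : ℝ)⌉₊ k : ℕ) : ℝ) := by ring
    _ < _ := hscale
    _ = _ := by field_simp
end
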